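/- Persistence of the total filling: in the stationary process of the DSS, let z(t) = Σ_{x=1}^L z(x,t). Then for every t ≥ 0: if 1 ≤ τ ≤ L−1, Cov(z(t), z(t+τ)) = pq · Σ_{x=τ+1}^L P(0|τ, x−1), and this covariance is strictly positive; if τ ≥ L, Cov(z(t), z(t+τ)) = 0. -/

import Mathlib

namespace RW

/-- Free random walk: `Pfree α β τ x y` is the probability that a walk started at `τ`,
making steps `+1`, `-1` (probability `α` each) and `0` (probability `β`), is at `y`
after `x` time steps. -/
noncomputable def Pfree (α β : ℝ) (τ : ℤ) : ℕ → ℤ → ℝ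
  | 0, y => if y = τ then 1 else 0
  | x + 1, y => α * Pfree α β τ x (y - 1) + α * Pfree α β τ x (y + 1) + β * Pfree α β τ x y

/-- Absorbed random walk: `Pabs α β τ x y` is the probability that the walk started at
`τ ≥ 1`, with an absorbing wall at height `0`, is at `y` after `x` time steps (being at `0`
means having been absorbed before or at time `x`). -/
noncomputable def Pabs (α β : ℝ) (τ : ℕ) : ℕ → ℕ → ℝ
  | 0, y => if y = τ then 1 else 0
  | x + 1, 0 => α * Pabs α β τ x 1 + Pabs α β τ x 0
  | x + 1, 1 => α * Pabs α β τ x 2 + β * Pabs α β τ x 1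
  | x + 1, (y + 2) =>
      α * Pabs α β τ x (y + 1) + α * Pabs α β τ x (y + 3) + β * Pabs α β τ x (y + 2)

/-- The error function `erf z = (2/√π) ∫_0^z e^(-t²) dt`. -/
noncomputable def erf (z : ℝ) : ℝ :=
  2 / Real.sqrt Real.pi * ∫ t in (0:ℝ)..z, Real.exp (-t ^ 2)


end RW


namespace DSS

/-- A state of the DSS on `L` sites: a stable field `z : Fin L → Bool` together with a
finite multiset `w` of waiting particles (particles past site `L` have left the system). -/
structure State (L : ℕ) where
  z : Fin L → Bool
  w : Multiset (Fin L)

variable {L : ℕ}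

/-- The multiset holding the right neighbour of `x`; empty if the particle leaves the system. -/
def succSite (L : ℕ) (x : Fin L) : Multiset (Fin L) :=
  if h : x.val + 1 < L then {(⟨x.val + 1, h⟩ : Fin L)} else 0

/-- Evolution of a waiting particle at `x` when `z x = 1`: the waiting particle moves to
`x+1` and the stable particle at `x` becomes a waiting particle at `x`. -/
def topple (s : State L) (x : Fin L) : State L :=
  ⟨Function.update s.z x false, s.w + succSite L x⟩

/-- Evolution of a waiting particle at `x` when `z x = 0`, settling branch (probability p). -/
def settle (s : State L) (x : Fin L) : State L :=
  ⟨Function.update s.z x true, s.w.erase x⟩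

/-- Evolution of a waiting particle at `x` when `z x = 0`, jumping branch (probability q). -/
def jump (s : State L) (x : Fin L) : State L :=
  ⟨s.z, s.w.erase x + succSite L x⟩

/-- `stabilizeAux p q R n s c` is the probability that, evolving one waiting particle at a
time (the particle being selected by the rule `R`), the process started from `s` reaches
within `n` elementary steps a stable state whose stable field is `c`. -/
noncomputable def stabilizeAux (p q : ℝ) (R : State L → Option (Fin L)) :
    ℕ → State L → (Fin L → Bool) → ℝ
  | 0, s, c => if s.w = 0 ∧ s.z = c then 1 else 0
  | n + 1, s, c =>
    match R s with
    | none => if s.z = c then 1 else 0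
    | some x =>
      if s.z x then stabilizeAux p q R n (topple s x) c
      else p * stabilizeAux p q R n (settle s x) c
        + q * stabilizeAux p q R n (jump s x) c

/-- The canonical evolution rule: evolve the leftmost waiting particle. -/
def minRule (s : State L) : Option (Fin L) :=
  if h : s.w = 0 then none
  else some (s.w.toFinset.min'
    (Finset.nonempty_iff_ne_empty.mpr (by simpa [Multiset.toFinset_eq_empty] using h)))

/-- A termination measure: the stabilization process started from `s` ends after at most
`fuel s` elementary steps, whatever the rule and the randomness. -/
def potential (s : State L) : ℕ :=
  (s.w.map fun x => L + 1 - x.val).sum + ∑ x : Fin L, (if s.z x then L + 1 - x.val else 0)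

def fuel (s : State L) : ℕ := 2 * potential s + Multiset.card s.w

/-- Add one waiting particle at site `1` (index `0`). -/
def addGrain (r : Fin L → Bool) : State L :=
  ⟨r, if h : 0 < L then {(⟨0, h⟩ : Fin L)} else 0⟩

/-- The driven-dissipative transition kernel `W` of the DSS: add a particle at site 1 and
stabilize. -/
noncomputable def Wker (p q : ℝ) (r r' : Fin L → Bool) : ℝ :=
  stabilizeAux p q minRule (fuel (addGrain r)) (addGrain r) r'

/-- `W` as a matrix on stable configurations. -/
noncomputable def Wmat (p q : ℝ) (L : ℕ) :
    Matrix (Fin L → Bool) (Fin L → Bool) ℝ :=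
  Matrix.of fun r r' => Wker p q r r'

/-- The product Bernoulli(p) measure `ψ(r) = p^(Σ r) q^(L - Σ r)`. -/
noncomputable def psi (p q : ℝ) {L : ℕ} (r : Fin L → Bool) : ℝ :=
  p ^ (Finset.univ.filter fun x => r x = true).card *
    q ^ (L - (Finset.univ.filter fun x => r x = true).card)


/-- `E[z(t)]` for the total filling `z(t) = Σ_x z(x,t)` in the stationary process. -/
noncomputable def meanZtot (p q : ℝ) (L : ℕ) (t : ℕ) : ℝ :=
  ∑ r0 : Fin L → Bool, ∑ r1 : Fin L → Bool,
    psi p q r0 * ((Wmat p q L) ^ t) r0 r1 * (∑ x : Fin L, if r1 x then 1 else 0)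

/-- `Cov(z(t), z(t+τ))` for the total filling in the stationary process. -/
noncomputable def covZtot (p q : ℝ) (L : ℕ) (t τ : ℕ) : ℝ :=
  (∑ r0 : Fin L → Bool, ∑ r1 : Fin L → Bool, ∑ r2 : Fin L → Bool,
      psi p q r0 * ((Wmat p q L) ^ t) r0 r1 * (∑ x : Fin L, if r1 x then 1 else 0) *
        ((Wmat p q L) ^ τ) r1 r2 * (∑ x : Fin L, if r2 x then 1 else 0))
    - meanZtot p q L t * meanZtot p q L (t + τ)

end DSS

namespace RW

lemma Pabs_zero_absorbed (α β : ℝ) (x y : ℕ) :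
    Pabs α β 0 x y = if y = 0 then 1 else 0 := by
  induction x using Nat.strong_induction_on generalizing y with
  | _ x ih =>
    rcases x with _ | x
    · rfl
    · rcases y with _ | _ | y <;> simp [Pabs, ih x (Nat.lt_succ_self x)]

/-- Backward equation: condition on the first step of the absorbed walk. -/
lemma Pabs_first_step (α β : ℝ) (n x y : ℕ) :
    Pabs α β (n + 1) (x + 1) y =
      α * Pabs α β (n + 2) x y + α * Pabs α β n x y + β * Pabs α β (n + 1) x y := by
  induction x generalizing y with
  | zero =>
    rcases y with _ | _ | y
    · rcases n with _ | n <;> simp [Pabs]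
    · simp only [Pabs]
      rcases n with _ | _ | n <;> simp
    · simp only [Pabs]
      have h1 : y + 1 = n + 1 ↔ y + 1 + 1 = n + 2 := by omega
      have h2 : y + 3 = n + 1 ↔ y + 1 + 1 = n := by omega
      have h3 : y + 2 = n + 1 ↔ y + 1 + 1 = n + 1 := by omega
      simp only [h1, h2, h3]
  | succ x ih =>
    rcases y with _ | _ | y
    · conv_lhs => rw [Pabs, ih, ih]
      simp only [Pabs]
      ring
    · conv_lhs => rw [Pabs, ih, ih]
      simp only [Pabs]
      ring
    · conv_lhs => rw [Pabs, ih, ih, ih]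
      simp only [Pabs]
      ring

lemma Pabs_eq_zero_of_lt (α β : ℝ) {n x : ℕ} (h : x < n) : Pabs α β n x 0 = 0 := by
  induction x generalizing n with
  | zero => simp [Pabs, h.ne]
  | succ x ih =>
    obtain ⟨n, rfl⟩ : ∃ k, n = k + 1 := ⟨n - 1, by omega⟩
    rw [Pabs_first_step, ih (by omega), ih (by omega), ih (by omega)]
    simp

lemma Pabs_pos_of_le {α β : ℝ} (hα : 0 < α) (hβ : 0 ≤ β) {n x : ℕ} (h : n ≤ x) :
    0 < Pabs α β n x 0 := by
  induction x generalizing n with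
  | zero => simp [Pabs, Nat.le_zero.mp h]
  | succ x ih =>
    rcases n with _ | n
    · simp [Pabs_zero_absorbed]
    have hnn (k : ℕ) : 0 ≤ Pabs α β k x 0 := by
      rcases le_or_gt k x with hk | hk
      · exact (ih hk).le
      · exact (Pabs_eq_zero_of_lt α β hk).ge
    rw [Pabs_first_step]
    have h1 := mul_nonneg hα.le (hnn (n + 2))
    have h2 := mul_pos hα (ih (n := n) (by omega))
    have h3 := mul_nonneg hβ (hnn (n + 1))
    linarith

end RW

namespace DSS

/-- The probability that a freshly visited site ends up in the state `a`. -/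
def siteWeight (p q : ℝ) (a : Bool) : ℝ := if a then p else q

/-- The number of particles leaving a site which receives `N` particles while its stable
state changes from `a` to `b`. -/
def outflow (N : ℕ) (a b : Bool) : ℕ := N + a.toNat - b.toNat

/-- The probability that the stable field `z` is turned into `c` when `n` particles enter
through the first site and `m x` further waiting particles are present at each site `x`. -/
noncomputable def flowKernel (p q : ℝ) :
    (L : ℕ) → ℕ → (Fin L → ℕ) → (Fin L → Bool) → (Fin L → Bool) → ℝ
  | 0, _, _, _, _ => 1
  | L + 1, n, m, z, c =>
    if n + m 0 = 0 then
      if z 0 = c 0 then flowKernel p q L 0 (Fin.tail m) (Fin.tail z) (Fin.tail c) else 0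
    else siteWeight p q (c 0) *
      flowKernel p q L (outflow (n + m 0) (z 0) (c 0)) (Fin.tail m) (Fin.tail z) (Fin.tail c)

/-- One particle at the site with index `k`, if there is such a site. -/
def oneAt (L k : ℕ) (i : Fin L) : ℕ := if i.val = k then 1 else 0

lemma tail_add_oneAt_zero {L : ℕ} (m : Fin (L + 1) → ℕ) :
    Fin.tail (m + oneAt (L + 1) 0) = Fin.tail m := by
  funext i; simp [Fin.tail, oneAt]

lemma tail_add_oneAt_succ {L : ℕ} (m : Fin (L + 1) → ℕ) (k : ℕ) :
    Fin.tail (m + oneAt (L + 1) (k + 1)) = Fin.tail m + oneAt L k := by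
  funext i; simp [Fin.tail, oneAt]

lemma flowKernel_add_oneAt_zero (p q : ℝ) {L : ℕ} (n : ℕ) (m : Fin L → ℕ)
    (z c : Fin L → Bool) :
    flowKernel p q L n (m + oneAt L 0) z c = flowKernel p q L (n + 1) m z c := by
  cases L with
  | zero => rfl
  | succ L =>
    have h : n + (m + oneAt (L + 1) 0) 0 = n + 1 + m 0 := by simp [oneAt]; omega
    simp only [flowKernel, tail_add_oneAt_zero, h]

lemma flowKernel_zero_zero (p q : ℝ) {L : ℕ} (z c : Fin L → Bool) :
    flowKernel p q L 0 0 z c = if z = c then 1 else 0 := by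
  induction L with
  | zero => simp [flowKernel, Subsingleton.elim z c]
  | succ L ih =>
    have h0 : Fin.tail (0 : Fin (L + 1) → ℕ) = 0 := rfl
    have hz : z = c ↔ z 0 = c 0 ∧ Fin.tail z = Fin.tail c := by
      constructor
      · rintro rfl; exact ⟨rfl, rfl⟩
      · rintro ⟨h1, h2⟩
        rw [← Fin.cons_self_tail z, ← Fin.cons_self_tail c, h1, h2]
    simp only [flowKernel, h0, ih, hz]
    simp [ite_and]

lemma flowKernel_topple (p q : ℝ) {L : ℕ} (n : ℕ) (m : Fin L → ℕ) (z c : Fin L → Bool)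
    (x : Fin L) (hz : z x = true) (hm : m x ≠ 0) :
    flowKernel p q L n m z c =
      flowKernel p q L n (m + oneAt L (x.val + 1)) (Function.update z x false) c := by
  induction L generalizing n with
  | zero => exact x.elim0
  | succ L ih =>
    have h0 (k : ℕ) : (m + oneAt (L + 1) (k + 1)) 0 = m 0 := by simp [oneAt]
    simp only [flowKernel, tail_add_oneAt_succ, h0]
    cases x using Fin.cases with
    | zero =>
      have hN : n + m 0 ≠ 0 := by omega
      have ho : outflow (n + m 0) true (c 0) = outflow (n + m 0) false (c 0) + 1 := by
        cases c 0 <;> simp [outflow]; omega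
      simp only [hN, if_false, Fin.val_zero, Fin.tail_update_zero, Function.update_self,
        flowKernel_add_oneAt_zero, hz, ho]
    | succ y =>
      have hne : (0 : Fin (L + 1)) ≠ y.succ := (Fin.succ_ne_zero y).symm
      simp only [Fin.val_succ, Fin.tail_update_succ, Function.update_of_ne hne]
      simp only [ih _ (Fin.tail m) (Fin.tail z) (Fin.tail c) y hz hm]

lemma flowKernel_settle_jump (p q : ℝ) (hpq : p + q = 1) {L : ℕ} (n : ℕ) (m : Fin L → ℕ)
    (z c : Fin L → Bool) (x : Fin L) (hz : z x = false) :
    flowKernel p q L n (m + oneAt L x.val) z c =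
      p * flowKernel p q L n m (Function.update z x true) c +
        q * flowKernel p q L n (m + oneAt L (x.val + 1)) z c := by
  induction L generalizing n with
  | zero => exact x.elim0
  | succ L ih =>
    have h0 (k : ℕ) : (m + oneAt (L + 1) (k + 1)) 0 = m 0 := by simp [oneAt]
    cases x using Fin.cases with
    | zero =>
      have h1 : n + (m + oneAt (L + 1) 0) 0 = n + m 0 + 1 := by simp [oneAt]; omega
      simp only [flowKernel, Fin.val_zero, tail_add_oneAt_succ, tail_add_oneAt_zero, h0, h1,
        Fin.tail_update_zero, Function.update_self, flowKernel_add_oneAt_zero, hz]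
      generalize n + m 0 = N
      have hq : q = 1 - p := by linarith
      rcases N with _ | N
      · cases c 0 <;> simp [outflow, siteWeight]
      · cases c 0
        · simp [outflow, siteWeight, hq]; ring
        · simp [outflow, siteWeight, hq]; ring
    | succ y =>
      have hne : (0 : Fin (L + 1)) ≠ y.succ := (Fin.succ_ne_zero y).symm
      simp only [flowKernel, Fin.val_succ, tail_add_oneAt_succ, h0, Fin.tail_update_succ,
        Function.update_of_ne hne,
        ih _ (Fin.tail m) (Fin.tail z) (Fin.tail c) y hz]
      split_ifs <;> ring

lemma count_succSite {L : ℕ} (x i : Fin L) :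
    (succSite L x).count i = oneAt L (x.val + 1) i := by
  have h := i.isLt
  unfold succSite oneAt
  split_ifs with h1 h2 h2
  · simp [Fin.ext_iff, h2]
  · simp [Fin.ext_iff, h2]
  · omega
  · simp

/-- The number of waiting particles of a state at each site. -/
def waiting {L : ℕ} (s : State L) (i : Fin L) : ℕ := s.w.count i

lemma waiting_topple {L : ℕ} (s : State L) (x : Fin L) :
    waiting (topple s x) = waiting s + oneAt L (x.val + 1) := by
  funext i; simp [waiting, topple, count_succSite]

lemma waiting_jump {L : ℕ} (s : State L) (x : Fin L) :
    waiting (jump s x) = waiting (settle s x) + oneAt L (x.val + 1) := by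
  funext i; simp [waiting, jump, settle, count_succSite]

lemma waiting_eq_settle {L : ℕ} (s : State L) (x : Fin L) (hx : x ∈ s.w) :
    waiting s = waiting (settle s x) + oneAt L x.val := by
  funext i
  conv_lhs => rw [waiting, ← Multiset.cons_erase hx, Multiset.count_cons]
  simp [waiting, settle, oneAt, Fin.ext_iff]

lemma succSite_cost {L : ℕ} (x : Fin L) :
    ((succSite L x).map fun y => L + 1 - y.val).sum + 1 ≤ L + 1 - x.val ∧
      (succSite L x).card ≤ 1 := by
  have h := x.isLt
  unfold succSite
  split_ifs
  · simp; omega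
  · simp; omega

lemma sum_update_cost {L : ℕ} (z : Fin L → Bool) (x : Fin L) (hz : z x = false) :
    (∑ y : Fin L, if Function.update z x true y then L + 1 - y.val else 0) =
      (∑ y : Fin L, if z y then L + 1 - y.val else 0) + (L + 1 - x.val) := by
  rw [← Finset.add_sum_erase _ _ (Finset.mem_univ x),
    ← Finset.add_sum_erase _ (fun y => if z y then L + 1 - y.val else 0) (Finset.mem_univ x)]
  have : ∀ y ∈ Finset.univ.erase x, (if Function.update z x true y then L + 1 - y.val else 0) =
      if z y then L + 1 - y.val else 0 := by
    intro y hy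
    rw [Function.update_of_ne (Finset.ne_of_mem_erase hy)]
  rw [Finset.sum_congr rfl this]
  simp [hz]; omega

lemma erase_cost {L : ℕ} (w : Multiset (Fin L)) (x : Fin L) (hx : x ∈ w) :
    (w.map fun y => L + 1 - y.val).sum =
      ((w.erase x).map fun y => L + 1 - y.val).sum + (L + 1 - x.val) ∧
    w.card = (w.erase x).card + 1 := by
  conv =>
    congr
    · lhs; rw [← Multiset.cons_erase hx]
    · lhs; rw [← Multiset.cons_erase hx]
  simp
  omega

lemma fuel_mk {L : ℕ} (z : Fin L → Bool) (w : Multiset (Fin L)) :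
    fuel ⟨z, w⟩ = 2 * ((w.map fun x => L + 1 - x.val).sum +
      ∑ x : Fin L, (if z x then L + 1 - x.val else 0)) + w.card :=
  rfl

lemma fuel_topple_lt {L : ℕ} (s : State L) (x : Fin L) (hz : s.z x = true) :
    fuel (topple s x) < fuel s := by
  obtain ⟨z, w⟩ := s
  have h1 := succSite_cost x
  have h2 := sum_update_cost (Function.update z x false) x (by simp)
  have h3 : Function.update z x true = z := by
    rw [← show z x = true from hz]
    exact Function.update_eq_self x z
  rw [Function.update_idem, h3] at h2
  simp only [topple, fuel_mk, Multiset.map_add, Multiset.sum_add, Multiset.card_add]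
  omega

lemma fuel_settle_lt {L : ℕ} (s : State L) (x : Fin L) (hx : x ∈ s.w) (hz : s.z x = false) :
    fuel (settle s x) < fuel s := by
  obtain ⟨z, w⟩ := s
  have h1 := erase_cost w x hx
  have h2 := sum_update_cost z x hz
  simp only [settle, fuel_mk]
  omega

lemma fuel_jump_lt {L : ℕ} (s : State L) (x : Fin L) (hx : x ∈ s.w) :
    fuel (jump s x) < fuel s := by
  obtain ⟨z, w⟩ := s
  have h1 := erase_cost w x hx
  have h2 := succSite_cost x
  simp only [jump, fuel_mk, Multiset.map_add, Multiset.sum_add, Multiset.card_add]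
  omega

lemma flowKernel_stable (p q : ℝ) {L : ℕ} (s : State L) (c : Fin L → Bool) (hw : s.w = 0) :
    flowKernel p q L 0 (waiting s) s.z c = if s.z = c then 1 else 0 := by
  have : waiting s = 0 := by funext i; simp [waiting, hw]
  rw [this, flowKernel_zero_zero]

/-- Whatever the order in which waiting particles are evolved, the stabilization law is
given by `flowKernel`. -/
lemma stabilizeAux_eq_flowKernel (p q : ℝ) (hpq : p + q = 1) {L : ℕ}
    (R : State L → Option (Fin L)) (hnone : ∀ s, R s = none → s.w = 0)
    (hsome : ∀ s x, R s = some x → x ∈ s.w) (n : ℕ) (s : State L) (c : Fin L → Bool)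
    (hn : fuel s ≤ n) :
    stabilizeAux p q R n s c = flowKernel p q L 0 (waiting s) s.z c := by
  induction n generalizing s with
  | zero =>
    have hw : s.w = 0 := by
      rw [← Multiset.card_eq_zero]
      unfold fuel at hn
      omega
    simp [stabilizeAux, flowKernel_stable p q s c hw, hw]
  | succ n ih =>
    rw [stabilizeAux]
    split
    · next h => rw [flowKernel_stable p q s c (hnone s h)]
    · next x h =>
      have hx := hsome s x h
      split_ifs with hz
      · have := fuel_topple_lt s x hz
        rw [ih _ (by omega), waiting_topple]
        refine (flowKernel_topple p q 0 (waiting s) s.z c x hz ?_).symm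
        exact (Multiset.count_pos.mpr hx).ne'
      · have hz : s.z x = false := by simpa using hz
        have h1 := fuel_settle_lt s x hx hz
        have h2 := fuel_jump_lt s x hx
        rw [ih _ (by omega), ih _ (by omega), waiting_jump, waiting_eq_settle s x hx]
        exact (flowKernel_settle_jump p q hpq 0 _ s.z c x hz).symm

lemma minRule_eq_none {L : ℕ} (s : State L) (h : minRule s = none) : s.w = 0 := by
  unfold minRule at h
  split_ifs at h with h0
  exact h0

lemma mem_of_minRule_eq_some {L : ℕ} (s : State L) (x : Fin L) (h : minRule s = some x) :
    x ∈ s.w := by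
  unfold minRule at h
  split_ifs at h with h0
  rw [← Option.some.inj h, ← Multiset.mem_toFinset]
  exact Finset.min'_mem _ _

lemma Wker_eq_flowKernel (p q : ℝ) (hpq : p + q = 1) {L : ℕ} (r c : Fin L → Bool) :
    Wker p q r c = flowKernel p q L 1 0 r c := by
  rw [Wker, stabilizeAux_eq_flowKernel p q hpq minRule minRule_eq_none mem_of_minRule_eq_some
    _ _ _ le_rfl, ← zero_add 1, ← flowKernel_add_oneAt_zero]
  congr 1
  funext i
  have h : 0 < L := i.pos
  simp [waiting, addGrain, h, oneAt, Multiset.count_singleton, Fin.ext_iff]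

lemma sum_cons {L : ℕ} (f : (Fin (L + 1) → Bool) → ℝ) :
    ∑ r, f r = ∑ a : Bool, ∑ r : Fin L → Bool, f (Fin.cons a r) := by
  rw [← (Fin.consEquiv fun _ => Bool).sum_comp f, Fintype.sum_prod_type]
  rfl

lemma flowKernel_cons_succ (p q : ℝ) {L : ℕ} (n : ℕ) (a b : Bool) (r c : Fin L → Bool) :
    flowKernel p q (L + 1) (n + 1) 0 (Fin.cons a r) (Fin.cons b c) =
      siteWeight p q b * flowKernel p q L (outflow (n + 1) a b) 0 r c := by
  have h0 : Fin.tail (0 : Fin (L + 1) → ℕ) = 0 := rfl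
  simp [flowKernel, h0]

lemma sum_siteWeight (p q : ℝ) (hpq : p + q = 1) : ∑ a, siteWeight p q a = 1 := by
  simp [siteWeight, hpq]

lemma sum_flowKernel (p q : ℝ) (hpq : p + q = 1) (L n : ℕ) (r : Fin L → Bool) :
    ∑ c, flowKernel p q L n 0 r c = 1 := by
  induction L generalizing n with
  | zero => simp [flowKernel]
  | succ L ih =>
    rcases n with _ | n
    · simp [flowKernel_zero_zero]
    · rw [sum_cons, ← Fin.cons_self_tail r]
      simp only [flowKernel_cons_succ, ← Finset.mul_sum, ih, mul_one, sum_siteWeight p q hpq]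

/-- Adding `m` particles, then `n` particles, amounts to adding `m + n` particles. -/
lemma sum_flowKernel_mul_flowKernel (p q : ℝ) (hpq : p + q = 1) (L m n : ℕ)
    (r c : Fin L → Bool) :
    ∑ s, flowKernel p q L m 0 r s * flowKernel p q L n 0 s c =
      flowKernel p q L (m + n) 0 r c := by
  induction L generalizing m n with
  | zero => simp [flowKernel]
  | succ L ih =>
    rcases m with _ | m
    · simp [flowKernel_zero_zero]
    rcases n with _ | n
    · simp [flowKernel_zero_zero]
    rw [sum_cons, ← Fin.cons_self_tail r, ← Fin.cons_self_tail c]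
    have hout (b : Bool) : outflow (m + 1) (r 0) b + outflow (n + 1) b (c 0) =
        outflow (m + 1 + n + 1) (r 0) (c 0) := by
      cases b <;> cases r 0 <;> cases c 0 <;> simp [outflow] <;> omega
    have key (b : Bool) : ∑ s : Fin L → Bool,
        flowKernel p q (L + 1) (m + 1) 0 (Fin.cons (r 0) (Fin.tail r)) (Fin.cons b s) *
          flowKernel p q (L + 1) (n + 1) 0 (Fin.cons b s) (Fin.cons (c 0) (Fin.tail c)) =
        siteWeight p q b * (siteWeight p q (c 0) *
          flowKernel p q L (outflow (m + 1 + n + 1) (r 0) (c 0)) 0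
            (Fin.tail r) (Fin.tail c)) := by
      rw [← hout b, ← ih, Finset.mul_sum, Finset.mul_sum]
      refine Finset.sum_congr rfl fun s _ => ?_
      rw [flowKernel_cons_succ, flowKernel_cons_succ]
      ring
    rw [Finset.sum_congr rfl fun b _ => key b, ← Finset.sum_mul, sum_siteWeight p q hpq, one_mul,
      ← add_assoc, flowKernel_cons_succ]

lemma Wmat_pow_apply (p q : ℝ) (hpq : p + q = 1) (L t : ℕ) (r c : Fin L → Bool) :
    (Wmat p q L ^ t) r c = flowKernel p q L t 0 r c := by
  induction t generalizing c with
  | zero => simp [flowKernel_zero_zero, Matrix.one_apply]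
  | succ t ih =>
    rw [pow_succ, Matrix.mul_apply, ← sum_flowKernel_mul_flowKernel p q hpq]
    refine Finset.sum_congr rfl fun s _ => ?_
    rw [ih, Wmat, Matrix.of_apply, Wker_eq_flowKernel p q hpq]

lemma psi_eq_prod (p q : ℝ) {L : ℕ} (r : Fin L → Bool) :
    psi p q r = ∏ x, siteWeight p q (r x) := by
  simp only [siteWeight, Finset.prod_ite, Finset.prod_const, psi]
  congr 2
  have := Finset.card_filter_add_card_filter_not (s := (Finset.univ : Finset (Fin L)))
    (fun x => r x = true)
  rw [Finset.card_univ, Fintype.card_fin] at this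
  omega

lemma psi_cons (p q : ℝ) {L : ℕ} (a : Bool) (r : Fin L → Bool) :
    psi p q (Fin.cons a r : Fin (L + 1) → Bool) = siteWeight p q a * psi p q r := by
  simp [psi_eq_prod, Fin.prod_univ_succ]

lemma sum_psi (p q : ℝ) (hpq : p + q = 1) (L : ℕ) : ∑ r : Fin L → Bool, psi p q r = 1 := by
  induction L with
  | zero => simp [psi]
  | succ L ih =>
    simp only [sum_cons, psi_cons, ← Finset.mul_sum, ih, mul_one, sum_siteWeight p q hpq]

lemma sum_psi_mul_flowKernel (p q : ℝ) (hpq : p + q = 1) (L n : ℕ) (c : Fin L → Bool) :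
    ∑ r, psi p q r * flowKernel p q L n 0 r c = psi p q c := by
  induction L generalizing n with
  | zero => simp [flowKernel, psi]
  | succ L ih =>
    rcases n with _ | n
    · simp [flowKernel_zero_zero]
    rw [sum_cons, ← Fin.cons_self_tail c]
    have key (a : Bool) : ∑ r : Fin L → Bool, psi p q (Fin.cons a r : Fin (L + 1) → Bool) *
        flowKernel p q (L + 1) (n + 1) 0 (Fin.cons a r) (Fin.cons (c 0) (Fin.tail c)) =
        siteWeight p q a * (siteWeight p q (c 0) * psi p q (Fin.tail c)) := by
      rw [← ih (outflow (n + 1) a (c 0)), Finset.mul_sum, Finset.mul_sum]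
      refine Finset.sum_congr rfl fun r _ => ?_
      rw [flowKernel_cons_succ, psi_cons]
      ring
    rw [Finset.sum_congr rfl fun a _ => key a, ← Finset.sum_mul, sum_siteWeight p q hpq, one_mul,
      psi_cons]

/-- The total filling of a stable configuration. -/
def filling {L : ℕ} (r : Fin L → Bool) : ℝ := ∑ x : Fin L, if r x then 1 else 0

lemma filling_cons {L : ℕ} (a : Bool) (r : Fin L → Bool) :
    filling (Fin.cons a r : Fin (L + 1) → Bool) = (if a then 1 else 0) + filling r := by
  rw [filling, filling, Fin.sum_univ_succ]
  simp only [Fin.cons_zero, Fin.cons_succ]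

lemma sum_psi_mul_filling (p q : ℝ) (hpq : p + q = 1) (L : ℕ) :
    ∑ r : Fin L → Bool, psi p q r * filling r = p * L := by
  induction L with
  | zero => simp [filling]
  | succ L ih =>
    have key (a : Bool) : ∑ r : Fin L → Bool, psi p q (Fin.cons a r : Fin (L + 1) → Bool) *
        filling (Fin.cons a r : Fin (L + 1) → Bool) =
        siteWeight p q a * ((if a then 1 else 0) + p * L) := by
      trans siteWeight p q a * ((if a then 1 else 0) * ∑ r : Fin L → Bool, psi p q r +
        ∑ r : Fin L → Bool, psi p q r * filling r)
      · simp only [Finset.mul_sum, ← Finset.sum_add_distrib]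
        refine Finset.sum_congr rfl fun r _ => ?_
        rw [psi_cons, filling_cons]
        ring
      · rw [ih, sum_psi p q hpq, mul_one]
    rw [sum_cons, Finset.sum_congr rfl fun a _ => key a]
    simp only [Fintype.sum_bool, siteWeight]
    push_cast
    simp
    linear_combination p * L * hpq

/-- The second moment `E[z(0) z(n)]` of the total filling. -/
noncomputable def fillingCorr (p q : ℝ) (L n : ℕ) : ℝ :=
  ∑ r : Fin L → Bool, ∑ c : Fin L → Bool,
    psi p q r * flowKernel p q L n 0 r c * filling r * filling c

lemma sum_psi_flowKernel_affine (p q : ℝ) (hpq : p + q = 1) (L n : ℕ) (u v : ℝ) :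
    ∑ r : Fin L → Bool, ∑ c : Fin L → Bool,
      psi p q r * flowKernel p q L n 0 r c * (u + filling r) * (v + filling c) =
    u * v + (u + v) * (p * L) + fillingCorr p q L n := by
  have h1 : ∑ r : Fin L → Bool, ∑ c : Fin L → Bool, psi p q r * flowKernel p q L n 0 r c = 1 := by
    simp only [← Finset.mul_sum, sum_flowKernel p q hpq, mul_one, sum_psi p q hpq]
  have h2 : ∑ r : Fin L → Bool, ∑ c : Fin L → Bool,
      psi p q r * flowKernel p q L n 0 r c * filling r = p * L := by
    simp only [← Finset.sum_mul, ← Finset.mul_sum, sum_flowKernel p q hpq, mul_one,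
      sum_psi_mul_filling p q hpq]
  have h3 : ∑ r : Fin L → Bool, ∑ c : Fin L → Bool,
      psi p q r * flowKernel p q L n 0 r c * filling c = p * L := by
    rw [Finset.sum_comm]
    simp only [← Finset.sum_mul, sum_psi_mul_flowKernel p q hpq, sum_psi_mul_filling p q hpq]
  trans u * v * (∑ r : Fin L → Bool, ∑ c : Fin L → Bool, psi p q r * flowKernel p q L n 0 r c) +
    v * (∑ r : Fin L → Bool, ∑ c : Fin L → Bool,
      psi p q r * flowKernel p q L n 0 r c * filling r) +
    u * (∑ r : Fin L → Bool, ∑ c : Fin L → Bool,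
      psi p q r * flowKernel p q L n 0 r c * filling c) + fillingCorr p q L n
  · simp only [fillingCorr, Finset.mul_sum, ← Finset.sum_add_distrib]
    refine Finset.sum_congr rfl fun r _ => Finset.sum_congr rfl fun c _ => ?_
    ring
  · rw [h1, h2, h3]
    ring

lemma fillingCorr_zero (p q : ℝ) (hpq : p + q = 1) (L : ℕ) :
    fillingCorr p q L 0 = p * q * L + (p * L) ^ 2 := by
  have hdiag (L : ℕ) :
      fillingCorr p q L 0 = ∑ r : Fin L → Bool, psi p q r * filling r * filling r := by
    simp [fillingCorr, flowKernel_zero_zero]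
  rw [hdiag]
  induction L with
  | zero => simp [filling]
  | succ L ih =>
    have key (a : Bool) : ∑ r : Fin L → Bool, psi p q (Fin.cons a r : Fin (L + 1) → Bool) *
        filling (Fin.cons a r : Fin (L + 1) → Bool) *
          filling (Fin.cons a r : Fin (L + 1) → Bool) =
        siteWeight p q a * ((if a then 1 else 0) * 1 + 2 * (if a then 1 else 0) * (p * L) +
          (p * q * L + (p * L) ^ 2)) := by
      trans siteWeight p q a * ((if a then 1 else 0) * ∑ r : Fin L → Bool, psi p q r +
        2 * (if a then 1 else 0) * ∑ r : Fin L → Bool, psi p q r * filling r +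
        ∑ r : Fin L → Bool, psi p q r * filling r * filling r)
      · simp only [Finset.mul_sum, ← Finset.sum_add_distrib]
        refine Finset.sum_congr rfl fun r _ => ?_
        rw [psi_cons, filling_cons]
        cases a <;> simp <;> ring
      · rw [ih, sum_psi p q hpq, sum_psi_mul_filling p q hpq]
    rw [sum_cons, Finset.sum_congr rfl fun a _ => key a]
    simp only [Fintype.sum_bool, siteWeight]
    push_cast
    simp
    obtain rfl : q = 1 - p := by linarith
    ring

lemma fillingCorr_succ (p q : ℝ) (hpq : p + q = 1) (L n : ℕ) :
    fillingCorr p q (L + 1) (n + 1) =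
      p ^ 2 + 2 * p ^ 2 * L + p * q * fillingCorr p q L (n + 2) +
        p * q * fillingCorr p q L n + (1 - 2 * (p * q)) * fillingCorr p q L (n + 1) := by
  have key (a b : Bool) : ∑ r : Fin L → Bool, ∑ c : Fin L → Bool,
      psi p q (Fin.cons a r : Fin (L + 1) → Bool) *
        flowKernel p q (L + 1) (n + 1) 0 (Fin.cons a r) (Fin.cons b c) *
        filling (Fin.cons a r : Fin (L + 1) → Bool) *
        filling (Fin.cons b c : Fin (L + 1) → Bool) =
      siteWeight p q a * siteWeight p q b *
        ((if a then 1 else 0) * (if b then 1 else 0) +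
          ((if a then 1 else 0) + (if b then 1 else 0)) * (p * L) +
          fillingCorr p q L (outflow (n + 1) a b)) := by
    rw [← sum_psi_flowKernel_affine p q hpq]
    simp only [Finset.mul_sum]
    refine Finset.sum_congr rfl fun r _ => Finset.sum_congr rfl fun c _ => ?_
    rw [psi_cons, filling_cons, filling_cons, flowKernel_cons_succ]
    ring
  have hsplit : fillingCorr p q (L + 1) (n + 1) = ∑ a : Bool, ∑ b : Bool,
      ∑ r : Fin L → Bool, ∑ c : Fin L → Bool,
      psi p q (Fin.cons a r : Fin (L + 1) → Bool) *
        flowKernel p q (L + 1) (n + 1) 0 (Fin.cons a r) (Fin.cons b c) *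
        filling (Fin.cons a r : Fin (L + 1) → Bool) *
        filling (Fin.cons b c : Fin (L + 1) → Bool) := by
    rw [fillingCorr, sum_cons]
    refine Finset.sum_congr rfl fun a _ => ?_
    rw [Finset.sum_comm]
    simp only [sum_cons]
    refine Finset.sum_congr rfl fun b _ => Finset.sum_comm
  rw [hsplit]
  simp only [key]
  simp only [Fintype.sum_bool, siteWeight, outflow]
  simp
  obtain rfl : q = 1 - p := by linarith
  ring

lemma fillingCorr_eq (p q : ℝ) (hpq : p + q = 1) (L n : ℕ) :
    fillingCorr p q L n = (p * L) ^ 2 +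
      p * q * ∑ i ∈ Finset.range L, RW.Pabs (p * q) (1 - 2 * (p * q)) n i 0 := by
  induction L generalizing n with
  | zero => simp [fillingCorr, filling]
  | succ L ih =>
    rcases n with _ | n
    · rw [fillingCorr_zero p q hpq]
      simp [RW.Pabs_zero_absorbed]
      ring
    · rw [fillingCorr_succ p q hpq, ih, ih, ih, Finset.sum_range_succ']
      simp only [RW.Pabs_first_step, Finset.sum_add_distrib, ← Finset.mul_sum]
      simp [RW.Pabs]
      ring

lemma meanZtot_eq (p q : ℝ) (hpq : p + q = 1) (L t : ℕ) : meanZtot p q L t = p * L := by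
  rw [meanZtot, Finset.sum_comm, ← sum_psi_mul_filling p q hpq]
  simp only [Wmat_pow_apply p q hpq, ← Finset.sum_mul, sum_psi_mul_flowKernel p q hpq, filling]

lemma covZtot_eq (p q : ℝ) (hpq : p + q = 1) (L t τ : ℕ) :
    covZtot p q L t τ =
      p * q * ∑ i ∈ Finset.Ico τ L, RW.Pabs (p * q) (1 - 2 * (p * q)) τ i 0 := by
  have h : (∑ r0 : Fin L → Bool, ∑ r1 : Fin L → Bool, ∑ r2 : Fin L → Bool,
      psi p q r0 * ((Wmat p q L) ^ t) r0 r1 * (∑ x : Fin L, if r1 x then 1 else 0) *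
        ((Wmat p q L) ^ τ) r1 r2 * (∑ x : Fin L, if r2 x then 1 else 0)) =
      fillingCorr p q L τ := by
    rw [Finset.sum_comm, fillingCorr]
    refine Finset.sum_congr rfl fun r1 _ => ?_
    rw [Finset.sum_comm]
    refine Finset.sum_congr rfl fun r2 _ => ?_
    simp only [Wmat_pow_apply p q hpq, ← Finset.sum_mul, sum_psi_mul_flowKernel p q hpq, filling]
    ring
  have hsum : ∑ i ∈ Finset.Ico τ L, RW.Pabs (p * q) (1 - 2 * (p * q)) τ i 0 =
      ∑ i ∈ Finset.range L, RW.Pabs (p * q) (1 - 2 * (p * q)) τ i 0 := by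
    refine Finset.sum_subset (fun i hi => ?_) fun i hi hi' => RW.Pabs_eq_zero_of_lt _ _ ?_
    · simp only [Finset.mem_Ico] at hi
      simpa using hi.2
    · simp only [Finset.mem_range, Finset.mem_Ico] at hi hi'
      omega
  rw [covZtot, h, meanZtot_eq p q hpq, meanZtot_eq p q hpq, fillingCorr_eq p q hpq, hsum]
  ring

/-- persistence of the total filling. If `1 ≤ τ ≤ L-1` then
`Cov(z(t), z(t+τ)) = pq Σ_{x=τ+1}^{L} P(0|τ,x-1)` (paper sites; the sum below runs over
the corresponding walk lengths `τ, …, L-1`) and this covariance is strictly positive;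
if `τ ≥ L` it vanishes. -/
theorem total_filling_is_persistent
    (L : ℕ) (hL : 0 < L) (p q : ℝ) (hp : 0 < p) (hq : 0 < q) (hpq : p + q = 1)
    (t τ : ℕ) (hτ : 1 ≤ τ) :
    (τ ≤ L - 1 →
      covZtot p q L t τ =
        p * q * ∑ i ∈ Finset.Ico τ L, RW.Pabs (p * q) (1 - 2 * (p * q)) τ i 0 ∧
      0 < covZtot p q L t τ) ∧
    (L ≤ τ → covZtot p q L t τ = 0) := by
  refine ⟨fun h => ⟨covZtot_eq p q hpq L t τ, ?_⟩, fun h => ?_⟩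
  · rw [covZtot_eq p q hpq]
    have hβ : 0 ≤ 1 - 2 * (p * q) := by nlinarith [sq_nonneg p, sq_nonneg q]
    refine mul_pos (mul_pos hp hq) (Finset.sum_pos (fun i hi => ?_) ⟨τ, ?_⟩)
    · exact RW.Pabs_pos_of_le (mul_pos hp hq) hβ (Finset.mem_Ico.mp hi).1
    · rw [Finset.mem_Ico]
      omega
  · rw [covZtot_eq p q hpq, Finset.Ico_eq_empty_of_le h]
    simp

end DSS
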